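/- Let ℓ, k, r, q be integers with ℓ ≥ 1, k ≥ 1, r ≥ 2, q ≥ 2, let A = (a₁ ≥ a₂ ≥ ⋯ ≥ a_r ≥ 1) and B = (b₁ ≥ b₂ ≥ ⋯ ≥ b_q ≥ 1) be partitions of ℓ with a₁ + b₁ ≤ k. Then the sets R^ℓ_{A,B} and W^ℓ_{A,B} have the same (finite) cardinality: |R^ℓ_{A,B}| = |W^ℓ_{A,B}|. -/

import Mathlib

/-- `StepSet τ j σ` : σ is obtained from the partition (Young diagram) τ by decreasing
exactly `j` distinct parts of τ by 1; equivalently `|σ| + j = |τ|` and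
`τᵢ - 1 ≤ σᵢ ≤ τᵢ` for every row `i`.  This is the set `S^τ_j` of the paper. -/
def StepSet (τ : YoungDiagram) (j : ℕ) (σ : YoungDiagram) : Prop :=
  σ.card + j = τ.card ∧ ∀ i, σ.rowLen i ≤ τ.rowLen i ∧ τ.rowLen i ≤ σ.rowLen i + 1

/-- The Young diagram is a single column `(1,1,…,1)` with `m` parts equal to 1. -/
def IsColumn (m : ℕ) (σ : YoungDiagram) : Prop :=
  ∀ i, σ.rowLen i = if i < m then 1 else 0

/-- `T` is a standard Young tableau of shape `μ`: entries strictly increase along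
rows and down columns, vanish outside `μ`, and the entries on the cells of `μ`
are exactly `1, …, μ.card`, each used exactly once. -/
def IsSYT (μ : YoungDiagram) (T : ℕ → ℕ → ℕ) : Prop :=
  (∀ i j1 j2, j1 < j2 → (i, j2) ∈ μ → T i j1 < T i j2) ∧
  (∀ i1 i2 j, i1 < i2 → (i2, j) ∈ μ → T i1 j < T i2 j) ∧
  (∀ i j, (i, j) ∉ μ → T i j = 0) ∧
  μ.cells.image (fun c => T c.1 c.2) = Finset.Icc 1 μ.card ∧
  Set.InjOn (fun c : ℕ × ℕ => T c.1 c.2) ↑μ.cells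

/-- The `j`-th (0-indexed) block of `[ℓ] = {1, …, ℓ}` determined by a partition `A`:
`Block A j = {A 0 + ⋯ + A (j-1) + 1, …, A 0 + ⋯ + A j}`. -/
def Block (A : ℕ → ℕ) (j : ℕ) : Finset ℕ :=
  Finset.Ioc (∑ i ∈ Finset.range j, A i) (∑ i ∈ Finset.range (j + 1), A i)

/-- For each block `Block A j` (`j < r`), entries of the block occur in strictly
increasing rows of the tableau `T` of shape `μ`. -/
def BlockRowCond (r : ℕ) (A : ℕ → ℕ) (μ : YoungDiagram) (T : ℕ → ℕ → ℕ) : Prop :=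
  ∀ j < r, ∀ m₁ ∈ Block A j, ∀ m₂ ∈ Block A j, m₁ < m₂ →
    ∀ c₁ ∈ μ.cells, ∀ c₂ ∈ μ.cells, T c₁.1 c₁.2 = m₁ → T c₂.1 c₂.2 = m₂ → c₁.1 < c₂.1

/-- The set `R^ℓ_{A,B}` of the paper, encoded as triples `(P, Q, τ)` where the
sequences `P` and `Q` are 0-indexed (so `P 0` is the paper's `P₁`, etc.). -/
def RSet (ℓ k r q : ℕ) (A B : ℕ → ℕ) :
    Set ((Fin (r - 1) → YoungDiagram) × (Fin (q - 1) → YoungDiagram) × YoungDiagram) :=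
  {x | x.2.2.card = ℓ ∧ x.2.2.colLen 0 ≤ k ∧ x.2.2.rowLen 0 ≤ min r q ∧
    (∀ i : Fin (r - 1), (i : ℕ) = 0 → StepSet x.2.2 (A 0) (x.1 i)) ∧
    (∀ i i' : Fin (r - 1), (i' : ℕ) = (i : ℕ) + 1 →
      StepSet (x.1 i) (A (i' : ℕ)) (x.1 i')) ∧
    (∀ i : Fin (r - 1), (i : ℕ) = r - 2 → IsColumn (A (r - 1)) (x.1 i)) ∧
    (∀ i : Fin (q - 1), (i : ℕ) = 0 → StepSet x.2.2 (B 0) (x.2.1 i)) ∧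
    (∀ i i' : Fin (q - 1), (i' : ℕ) = (i : ℕ) + 1 →
      StepSet (x.2.1 i) (B (i' : ℕ)) (x.2.1 i')) ∧
    (∀ i : Fin (q - 1), (i : ℕ) = q - 2 → IsColumn (B (q - 1)) (x.2.1 i))}

/-- The set `S^ℓ_{A,B}` of the paper: pairs `(M, N)` of standard Young tableaux of the
same shape `μ` with `ℓ` boxes, at most `k` rows, first row of length at most `min r q`,
`M` satisfying the row condition for the blocks `U_j` of `A`,
and `N` satisfying the row condition for the blocks `V_j` of `B`. -/
def SYTPairSet (ℓ k r q : ℕ) (A B : ℕ → ℕ) :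
    Set (YoungDiagram × (ℕ → ℕ → ℕ) × (ℕ → ℕ → ℕ)) :=
  {x | x.1.card = ℓ ∧ x.1.colLen 0 ≤ k ∧ x.1.rowLen 0 ≤ min r q ∧
    IsSYT x.1 x.2.1 ∧ IsSYT x.1 x.2.2 ∧
    BlockRowCond r A x.1 x.2.1 ∧ BlockRowCond q B x.1 x.2.2}

/-- The set `W^ℓ_{A,B}` of the paper: permutations `w` of `[ℓ] = {1, …, ℓ}` (extended by
the identity off `[ℓ]`) with no decreasing subsequence of length `k + 1`, such that for
`j₁ < j₂` in a common block `U_j` of `A`, `j₂` occurs in an earlier position than `j₁`,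
and for `j₁ < j₂` in a common block `V_j` of `B`, `w j₁ > w j₂`. -/
def WSet (ℓ k r q : ℕ) (A B : ℕ → ℕ) : Set (ℕ → ℕ) :=
  {w | Set.BijOn w (Set.Icc 1 ℓ) (Set.Icc 1 ℓ) ∧ (∀ m, m ∉ Set.Icc 1 ℓ → w m = m) ∧
    (∀ s : Fin (k + 1) → ℕ, StrictMono s → (∀ i, s i ∈ Set.Icc 1 ℓ) →
      ¬ StrictAnti (fun i => w (s i))) ∧
    (∀ j < r, ∀ m₁ ∈ Block A j, ∀ m₂ ∈ Block A j, m₁ < m₂ →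
      ∀ p₁ ∈ Set.Icc 1 ℓ, ∀ p₂ ∈ Set.Icc 1 ℓ, w p₁ = m₁ → w p₂ = m₂ → p₂ < p₁) ∧
    (∀ j < q, ∀ p₁ ∈ Block B j, ∀ p₂ ∈ Block B j, p₁ < p₂ → w p₂ < w p₁)}

def HS (μ ν : ℕ → ℕ) : Prop := ∀ p, μ p ≤ ν p ∧ ν (p + 1) ≤ μ p

def fstep (m : ℕ) (μ α β : ℕ → ℕ) : ℕ → ℕ
  | 0 => max (α 0) (β 0) + m
  | p + 1 => max (α (p + 1)) (β (p + 1)) + min (α p) (β p) - μ p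

def bstep (ν α β : ℕ → ℕ) (p : ℕ) : ℕ :=
  max (α (p + 1)) (β (p + 1)) + min (α p) (β p) - ν (p + 1)

lemma fstep_HS (m : ℕ) {μ α β : ℕ → ℕ} (h1 : HS μ α) (h2 : HS μ β) :
    HS α (fstep m μ α β) ∧ HS β (fstep m μ α β) := by
  constructor <;> intro p <;> have a := h1 p <;> have b := h2 p <;> cases p with
  | zero => simp only [fstep]; omega
  | succ p => have a' := h1 p; have b' := h2 p; simp only [fstep]; omega

lemma bstep_HS {ν α β : ℕ → ℕ} (h1 : HS α ν) (h2 : HS β ν) :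
    HS (bstep ν α β) α ∧ HS (bstep ν α β) β := by
  constructor <;> intro p <;> have a := h1 p <;> have b := h2 p <;>
    have a' := h1 (p + 1) <;> have b' := h2 (p + 1) <;> simp only [bstep] <;> omega

lemma bstep_fstep (m : ℕ) {μ α β : ℕ → ℕ} (h1 : HS μ α) (h2 : HS μ β) :
    bstep (fstep m μ α β) α β = μ := by
  funext p
  have a := h1 p
  have b := h2 p
  simp only [bstep, fstep]; omega

lemma fstep_bstep {ν α β : ℕ → ℕ} (h1 : HS α ν) (h2 : HS β ν) :
    fstep (ν 0 - max (α 0) (β 0)) (bstep ν α β) α β = ν := by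
  funext p
  have a := h1 0
  have b := h2 0
  cases p with
  | zero => simp only [fstep]; omega
  | succ p =>
    have a := h1 p
    have b := h2 p
    have a' := h1 (p + 1)
    have b' := h2 (p + 1)
    simp only [bstep, fstep]; omega

lemma sum_fstep (m N : ℕ) {μ α β : ℕ → ℕ} (h1 : HS μ α) (h2 : HS μ β) (h0 : α N = 0) :
    ∑ p ∈ Finset.range (N + 1), fstep m μ α β p + ∑ p ∈ Finset.range (N + 1), μ p =
      ∑ p ∈ Finset.range (N + 1), α p + ∑ p ∈ Finset.range (N + 1), β p + m := by
  have key : ∀ n, ∑ p ∈ Finset.range (n + 1), fstep m μ α β p + ∑ p ∈ Finset.range (n + 1), μ p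
      + min (α n) (β n) =
      ∑ p ∈ Finset.range (n + 1), α p + ∑ p ∈ Finset.range (n + 1), β p + m + μ n := by
    intro n
    induction n with
    | zero => simp [fstep]; omega
    | succ n ih =>
      rw [Finset.sum_range_succ _ (n + 1), Finset.sum_range_succ μ (n + 1),
        Finset.sum_range_succ α (n + 1), Finset.sum_range_succ β (n + 1)]
      have a := h1 n
      have b := h2 n
      have e : fstep m μ α β (n + 1) =
        max (α (n + 1)) (β (n + 1)) + min (α n) (β n) - μ n := rfl
      rw [e]
      omega
  have := key N
  have a := h1 N
  omega

def grid (s : ℕ → ℕ → (ℕ → ℕ) → (ℕ → ℕ) → (ℕ → ℕ) → (ℕ → ℕ)) (h v : ℕ → ℕ → ℕ) :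
    ℕ → ℕ → (ℕ → ℕ)
  | 0, j => h j
  | i + 1, 0 => v (i + 1)
  | i + 1, j + 1 => s i j (grid s h v i j) (grid s h v i (j + 1)) (grid s h v (i + 1) j)
termination_by i j => (i, j)

def Lam (m : ℕ → ℕ → ℕ) : ℕ → ℕ → (ℕ → ℕ) :=
  grid (fun i j => fstep (m i j)) (fun _ _ => 0) (fun _ _ => 0)

lemma Lam_zero_left (m : ℕ → ℕ → ℕ) (j : ℕ) : Lam m 0 j = fun _ => 0 := by
  unfold Lam; rw [grid]
lemma Lam_zero_right (m : ℕ → ℕ → ℕ) (i : ℕ) : Lam m i 0 = fun _ => 0 := by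
  unfold Lam; cases i <;> rw [grid]
lemma Lam_succ (m : ℕ → ℕ → ℕ) (i j : ℕ) :
    Lam m (i + 1) (j + 1) = fstep (m i j) (Lam m i j) (Lam m i (j + 1)) (Lam m (i + 1) j) := by
  unfold Lam; rw [grid]

lemma HS_zero : HS (fun _ => 0) (fun _ => 0) := fun _ => ⟨le_rfl, le_rfl⟩

lemma Lam_HS (m : ℕ → ℕ → ℕ) (i j : ℕ) :
    HS (Lam m i j) (Lam m (i + 1) j) ∧ HS (Lam m i j) (Lam m i (j + 1)) := by
  suffices H : ∀ i, (∀ j, HS (Lam m i j) (Lam m i (j + 1))) ∧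
      ∀ j, HS (Lam m i j) (Lam m (i + 1) j) from ⟨(H i).2 j, (H i).1 j⟩
  have step : ∀ i, (∀ j, HS (Lam m i j) (Lam m i (j + 1))) →
      ∀ j, HS (Lam m i j) (Lam m (i + 1) j) := by
    intro i hi j
    induction j with
    | zero => rw [Lam_zero_right, Lam_zero_right]; exact HS_zero
    | succ j ih => rw [Lam_succ]; exact (fstep_HS _ (hi j) ih).1
  intro i
  induction i with
  | zero =>
    have : ∀ j, HS (Lam m 0 j) (Lam m 0 (j + 1)) := by
      intro j; rw [Lam_zero_left, Lam_zero_left]; exact HS_zero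
    exact ⟨this, step 0 this⟩
  | succ i ih =>
    have : ∀ j, HS (Lam m (i + 1) j) (Lam m (i + 1) (j + 1)) := by
      intro j; rw [Lam_succ]; exact (fstep_HS _ (ih.1 j) (ih.2 j)).2
    exact ⟨this, step _ this⟩

lemma supp_of_HS {L : ℕ → ℕ → ℕ} {n : ℕ} (h0 : ∀ p, L 0 p = 0)
    (h : ∀ i < n, HS (L i) (L (i + 1))) : ∀ i ≤ n, ∀ p, i ≤ p → L i p = 0 := by
  intro i
  induction i with
  | zero => intro _ p _; exact h0 p
  | succ i ih =>
    intro hi p hp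
    obtain ⟨p, rfl⟩ : ∃ p', p = p' + 1 := ⟨p - 1, by omega⟩
    have := (h i (by omega) p).2
    have := ih (by omega) p (by omega)
    omega

lemma Lam_supp (m : ℕ → ℕ → ℕ) (i j p : ℕ) (hp : i ≤ p) : Lam m i j p = 0 :=
  supp_of_HS (L := fun i => Lam m i j) (n := i) (fun p => by rw [Lam_zero_left])
    (fun i _ => (Lam_HS m i j).1) i le_rfl p hp

lemma Lam_sum_row (m : ℕ → ℕ → ℕ) (N i j : ℕ) (hi : i ≤ N) :
    ∑ p ∈ Finset.range (N + 1), Lam m (i + 1) j p =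
      ∑ p ∈ Finset.range (N + 1), Lam m i j p + ∑ j' ∈ Finset.range j, m i j' := by
  induction j with
  | zero => simp [Lam_zero_right]
  | succ j ih =>
    have := sum_fstep (m i j) N (Lam_HS m i j).2 (Lam_HS m i j).1 (Lam_supp m i (j + 1) N hi)
    rw [← Lam_succ] at this
    rw [Finset.sum_range_succ _ j]
    omega

lemma Lam_sum_col (m : ℕ → ℕ → ℕ) (N i j : ℕ) (hi : i ≤ N) :
    ∑ p ∈ Finset.range (N + 1), Lam m i (j + 1) p =
      ∑ p ∈ Finset.range (N + 1), Lam m i j p + ∑ i' ∈ Finset.range i, m i' j := by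
  induction i with
  | zero => simp [Lam_zero_left]
  | succ i ih =>
    have := sum_fstep (m i j) N (Lam_HS m i j).2 (Lam_HS m i j).1
      (Lam_supp m i (j + 1) N (by omega))
    rw [← Lam_succ] at this
    rw [Finset.sum_range_succ _ i]
    have := ih (by omega)
    omega

def IsCh (N n : ℕ) (c : ℕ → ℕ) (L : ℕ → ℕ → ℕ) : Prop :=
  (∀ p, L 0 p = 0) ∧ (∀ i < n, HS (L i) (L (i + 1))) ∧
  (∀ i < n, ∑ p ∈ Finset.range (N + 1), L (i + 1) p =
    ∑ p ∈ Finset.range (N + 1), L i p + c i) ∧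
  ∀ i, n < i → L i = fun _ => 0

def Pairs (N k r q : ℕ) (a b : ℕ → ℕ) : Set ((ℕ → ℕ → ℕ) × (ℕ → ℕ → ℕ)) :=
  {x | IsCh N r a x.1 ∧ IsCh N q b x.2 ∧ x.1 r = x.2 q ∧ x.1 r 0 ≤ k}

def Mat (k r q : ℕ) (a b : ℕ → ℕ) : Set (ℕ → ℕ → ℕ) :=
  {m | (∀ i j, ¬ (i < r ∧ j < q) → m i j = 0) ∧
    (∀ i < r, ∑ j ∈ Finset.range q, m i j = a i) ∧
    (∀ j < q, ∑ i ∈ Finset.range r, m i j = b j) ∧ Lam m r q 0 ≤ k}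

lemma ncard_eq_of {α β : Type*} {s : Set α} {t : Set β} (f : α → β)
    (h1 : ∀ a ∈ s, f a ∈ t) (h2 : ∀ a ∈ s, ∀ b ∈ s, f a = f b → a = b)
    (h3 : ∀ b ∈ t, ∃ a ∈ s, f a = b) : s.ncard = t.ncard :=
  Set.ncard_congr (fun a _ => f a) h1 (fun a b ha hb h => h2 a ha b hb h)
    (fun b hb => by obtain ⟨a, ha, h⟩ := h3 b hb; exact ⟨a, ha, h⟩)

lemma Lam_back (m m' : ℕ → ℕ → ℕ) (r q : ℕ) (h1 : ∀ i ≤ r, Lam m i q = Lam m' i q)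
    (h2 : ∀ j ≤ q, Lam m r j = Lam m' r j) :
    ∀ u v, Lam m (r - u) (q - v) = Lam m' (r - u) (q - v) := by
  intro u
  induction u with
  | zero => intro v; exact h2 _ (by omega)
  | succ u ihu =>
    intro v
    induction v with
    | zero => exact h1 _ (by omega)
    | succ v ihv =>
      rcases Nat.lt_or_ge u r with hu | hu
      · rcases Nat.lt_or_ge v q with hv | hv
        · have e1 : r - u = (r - (u + 1)) + 1 := by omega
          have e2 : q - v = (q - (v + 1)) + 1 := by omega
          have x1 := ihu v
          have x2 := ihu (v + 1)
          rw [e1, e2] at x1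
          rw [e1] at x2
          rw [e2] at ihv
          generalize r - (u + 1) = i at *
          generalize q - (v + 1) = j at *
          rw [← bstep_fstep (m i j) (Lam_HS m i j).2 (Lam_HS m i j).1,
            ← bstep_fstep (m' i j) (Lam_HS m' i j).2 (Lam_HS m' i j).1,
            ← Lam_succ, ← Lam_succ, x1, x2, ihv]
        · have e2 : q - v = (q - (v + 1)) := by omega
          rw [← e2]; exact ihv
      · have e2 : r - u = (r - (u + 1)) := by omega
        rw [← e2]; exact ihu _

lemma rsk_inj (r q : ℕ) (m m' : ℕ → ℕ → ℕ) (hm : ∀ i j, ¬ (i < r ∧ j < q) → m i j = 0)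
    (hm' : ∀ i j, ¬ (i < r ∧ j < q) → m' i j = 0) (h1 : ∀ i ≤ r, Lam m i q = Lam m' i q)
    (h2 : ∀ j ≤ q, Lam m r j = Lam m' r j) : m = m' := by
  have H : ∀ i ≤ r, ∀ j ≤ q, Lam m i j = Lam m' i j := by
    intro i hi j hj
    have := Lam_back m m' r q h1 h2 (r - i) (q - j)
    rwa [show r - (r - i) = i by omega, show q - (q - j) = j by omega] at this
  funext i j
  by_cases hij : i < r ∧ j < q
  · have e := congrFun (H (i + 1) hij.1 (j + 1) hij.2) 0
    rw [Lam_succ, Lam_succ, H i hij.1.le (j + 1) hij.2, H (i + 1) hij.1 j hij.2.le] at e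
    simp only [fstep] at e
    omega
  · rw [hm i j hij, hm' i j hij]

lemma rsk_surj (N r q : ℕ) (a b : ℕ → ℕ) (L R : ℕ → ℕ → ℕ) (hL : IsCh N r a L)
    (hR : IsCh N q b R) (hLR : L r = R q) :
    ∃ m : ℕ → ℕ → ℕ, (∀ i j, ¬ (i < r ∧ j < q) → m i j = 0) ∧
      (∀ i ≤ r, Lam m i q = L i) ∧ (∀ j ≤ q, Lam m r j = R j) := by
  let G := grid (fun _ _ => bstep) (fun v => R (q - v)) (fun u => L (r - u))
  have G0 : ∀ v, G 0 v = R (q - v) := by intro v; simp only [G]; rw [grid]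
  have G1 : ∀ u, G u 0 = L (r - u) := by
    intro u
    cases u with
    | zero => rw [G0]; simp [hLR]
    | succ u => simp only [G]; rw [grid]
  have GS : ∀ u v, G (u + 1) (v + 1) = bstep (G u v) (G u (v + 1)) (G (u + 1) v) := by
    intro u v; simp only [G]; rw [grid]
  clear_value G
  have L0 : L 0 = fun _ => 0 := funext hL.1
  have R0 : R 0 = fun _ => 0 := funext hR.1
  have hH0 : ∀ u, HS (G (u + 1) 0) (G u 0) := by
    intro u
    rw [G1, G1]
    rcases Nat.lt_or_ge u r with hu | hu
    · have := hL.2.1 (r - (u + 1)) (by omega)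
      rwa [show r - (u + 1) + 1 = r - u by omega] at this
    · rw [show r - (u + 1) = 0 by omega, show r - u = 0 by omega, L0]; exact HS_zero
  have hV0 : ∀ u, HS (G 0 (u + 1)) (G 0 u) := by
    intro u
    rw [G0, G0]
    rcases Nat.lt_or_ge u q with hu | hu
    · have := hR.2.1 (q - (u + 1)) (by omega)
      rwa [show q - (u + 1) + 1 = q - u by omega] at this
    · rw [show q - (u + 1) = 0 by omega, show q - u = 0 by omega, R0]; exact HS_zero
  have step : ∀ u, (∀ v, HS (G u (v + 1)) (G u v)) → ∀ v, HS (G (u + 1) v) (G u v) := by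
    intro u hu v
    induction v with
    | zero => exact hH0 u
    | succ v ih => rw [GS]; exact (bstep_HS (hu v) ih).1
  have hV : ∀ u v, HS (G u (v + 1)) (G u v) := by
    intro u
    induction u with
    | zero => exact hV0
    | succ u ih => intro v; rw [GS]; exact (bstep_HS (ih v) (step u ih v)).2
  have hH : ∀ u v, HS (G (u + 1) v) (G u v) := fun u => step u (hV u)
  have Gr : ∀ v p, G r v p = 0 := by
    intro v
    induction v with
    | zero => intro p; rw [G1]; simp [L0]
    | succ v ih => intro p; have := (hV r v p).1; have := ih p; omega
  have Gq : ∀ u p, G u q p = 0 := by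
    intro v
    induction v with
    | zero => intro p; rw [G0]; simp [R0]
    | succ v ih => intro p; have := (hH v q p).1; have := ih p; omega
  let m : ℕ → ℕ → ℕ := fun i j => if i < r ∧ j < q then
    G (r - (i + 1)) (q - (j + 1)) 0 - max (G (r - i) (q - (j + 1)) 0) (G (r - (i + 1)) (q - j) 0)
    else 0
  have key : ∀ i ≤ r, ∀ j ≤ q, Lam m i j = G (r - i) (q - j) := by
    intro i
    induction i with
    | zero => intro _ j _; rw [Lam_zero_left]; funext p; simp [Gr]
    | succ i ih =>
      intro hi j
      induction j with
      | zero => intro _; rw [Lam_zero_right]; funext p; simp [Gq]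
      | succ j ihj =>
        intro hj
        rw [Lam_succ, ih (by omega) j (by omega), ih (by omega) (j + 1) hj, ihj (by omega)]
        have hm : m i j = G (r - (i + 1)) (q - (j + 1)) 0 -
          max (G (r - i) (q - (j + 1)) 0) (G (r - (i + 1)) (q - j) 0) := by
          simp only [m]; rw [if_pos ⟨by omega, by omega⟩]
        rw [hm, show r - i = r - (i + 1) + 1 by omega, show q - j = q - (j + 1) + 1 by omega, GS]
        have := fstep_bstep (hH (r - (i + 1)) (q - (j + 1))) (hV (r - (i + 1)) (q - (j + 1)))
        convert this using 2
        funext p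
        simp only [bstep]
        simp only [max_comm, min_comm]
  refine ⟨m, fun i j h => if_neg h, fun i hi => ?_, fun j hj => ?_⟩
  · rw [key i hi q le_rfl, Nat.sub_self, G1, show r - (r - i) = i by omega]
  · rw [key r le_rfl j hj, Nat.sub_self, G0, show q - (q - j) = j by omega]

lemma card_Mat_eq (N k r q : ℕ) (a b : ℕ → ℕ) (hN : r ≤ N) :
    (Mat k r q a b).ncard = (Pairs N k r q a b).ncard := by
  refine ncard_eq_of (fun m => (fun i => if i ≤ r then Lam m i q else fun _ => 0,
    fun j => if j ≤ q then Lam m r j else fun _ => 0)) ?_ ?_ ?_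
  · rintro m ⟨hm0, hm1, hm2, hm3⟩
    refine ⟨⟨?_, ?_, ?_, ?_⟩, ⟨?_, ?_, ?_, ?_⟩, ?_, ?_⟩
    · intro p; simp [Lam_zero_left]
    · intro i hi
      simp only [hi.le, Nat.succ_le_of_lt hi, if_true]
      exact (Lam_HS m i q).1
    · intro i hi
      simp only [hi.le, Nat.succ_le_of_lt hi, if_true]
      rw [Lam_sum_row m N i q (by omega), hm1 i hi]
    · intro i hi
      simp only [if_neg (not_le.2 hi)]
    · intro p; simp [Lam_zero_right]
    · intro i hi
      simp only [hi.le, Nat.succ_le_of_lt hi, if_true]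
      exact (Lam_HS m r i).2
    · intro i hi
      simp only [hi.le, Nat.succ_le_of_lt hi, if_true]
      rw [Lam_sum_col m N r i hN, hm2 i hi]
    · intro i hi
      simp only [if_neg (not_le.2 hi)]
    · simp
    · simpa using hm3
  · rintro m ⟨hm0, -⟩ m' ⟨hm0', -⟩ h
    rw [Prod.mk.injEq] at h
    refine rsk_inj r q m m' hm0 hm0' (fun i hi => ?_) (fun j hj => ?_)
    · simpa [hi] using congrFun h.1 i
    · simpa [hj] using congrFun h.2 j
  · rintro ⟨L, R⟩ ⟨hL, hR, hLR, hk⟩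
    dsimp only at hL hR hLR hk
    obtain ⟨m, h0, h1, h2⟩ := rsk_surj N r q a b L R hL hR hLR
    refine ⟨m, ⟨h0, ?_, ?_, ?_⟩, ?_⟩
    · intro i hi
      have e1 := Lam_sum_row m N i q (by omega)
      have e2 := hL.2.2.1 i hi
      rw [h1 i hi.le, h1 (i + 1) hi] at e1
      omega
    · intro i hi
      have e1 := Lam_sum_col m N r i hN
      have e2 := hR.2.2.1 i hi
      rw [h2 i hi.le, h2 (i + 1) hi] at e1
      omega
    · rw [h1 r le_rfl]; exact hk
    · ext i : 2
      · dsimp only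
        split_ifs with h
        · exact h1 i h
        · exact (hL.2.2.2 i (by omega)).symm
      · dsimp only
        split_ifs with h
        · exact h2 i h
        · exact (hR.2.2.2 i (by omega)).symm

def bk (μ ν α : ℕ → ℕ) : ℕ → ℕ
  | 0 => ν 0 + max (ν (0 + 1)) (μ 0) - α 0
  | p + 1 => min (ν (p + 1)) (μ p) + max (ν (p + 1 + 1)) (μ (p + 1)) - α (p + 1)

lemma bk_HS {μ ν α : ℕ → ℕ} (h1 : HS μ α) (h2 : HS α ν) :
    HS μ (bk μ ν α) ∧ HS (bk μ ν α) ν := by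
  constructor <;> intro p <;> have a := h1 p <;> have b := h2 p <;>
    have a' := h1 (p + 1) <;> have b' := h2 (p + 1) <;> cases p with
  | zero => simp only [bk]; omega
  | succ p => have a' := h1 p; have b' := h2 p; simp only [bk]; omega

lemma bk_bk {μ ν α : ℕ → ℕ} (h1 : HS μ α) (h2 : HS α ν) : bk μ ν (bk μ ν α) = α := by
  funext p
  have a := h1 p
  have b := h2 p
  cases p with
  | zero => simp only [bk]; omega
  | succ p => have a' := h1 p; have b' := h2 p; simp only [bk]; omega

lemma bk_sum {μ ν α : ℕ → ℕ} (h1 : HS μ α) (h2 : HS α ν) (N : ℕ) (hN : ν (N + 1) = 0) :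
    ∑ p ∈ Finset.range (N + 1), bk μ ν α p + ∑ p ∈ Finset.range (N + 1), α p =
    ∑ p ∈ Finset.range (N + 1), ν p + ∑ p ∈ Finset.range (N + 1), μ p := by
  have key : ∀ n, ∑ p ∈ Finset.range (n + 1), bk μ ν α p + ∑ p ∈ Finset.range (n + 1), α p + μ n =
    ∑ p ∈ Finset.range (n + 1), ν p + ∑ p ∈ Finset.range (n + 1), μ p + max (ν (n + 1)) (μ n) := by
    intro n
    induction n with
    | zero =>
      have a := h1 0
      have b := h2 0
      simp [bk]; simp only [Nat.zero_add] at *; omega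
    | succ n ih =>
      rw [Finset.sum_range_succ _ (n + 1), Finset.sum_range_succ μ (n + 1),
        Finset.sum_range_succ α (n + 1), Finset.sum_range_succ ν (n + 1)]
      have a := h1 n
      have b := h2 n
      have a' := h1 (n + 1)
      have b' := h2 (n + 1)
      have e : bk μ ν α (n + 1) =
        min (ν (n + 1)) (μ n) + max (ν (n + 1 + 1)) (μ (n + 1)) - α (n + 1) := rfl
      rw [e]
      omega
  have := key N
  omega

def tog (i : ℕ) (L : ℕ → ℕ → ℕ) : ℕ → ℕ → ℕ :=
  fun t => if t = i + 1 then bk (L i) (L (i + 1 + 1)) (L (i + 1)) else L t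

lemma tog_tog {N n : ℕ} {c : ℕ → ℕ} {L : ℕ → ℕ → ℕ} (h : IsCh N n c L) {i : ℕ}
    (hi : i + 1 < n) : tog i (tog i L) = L := by
  funext t
  unfold tog
  by_cases ht : t = i + 1
  · subst ht
    simp
    exact bk_bk (h.2.1 i (by omega)) (h.2.1 (i + 1) hi)
  · simp [ht]

lemma tog_IsCh {N n : ℕ} {c : ℕ → ℕ} {L : ℕ → ℕ → ℕ} (h : IsCh N n c L) (hN : n ≤ N) {i : ℕ}
    (hi : i + 1 < n) : IsCh N n (c ∘ Equiv.swap i (i + 1)) (tog i L) := by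
  have hs := supp_of_HS h.1 h.2.1
  obtain ⟨h0, h1, h2, h3⟩ := h
  have a1 := h1 i (by omega)
  have a2 := h1 (i + 1) hi
  have A := bk_HS a1 a2
  have B := bk_sum a1 a2 N (hs (i + 2) (by omega) _ (by omega))
  have s1 := h2 i (by omega)
  have s2 := h2 (i + 1) hi
  refine ⟨?_, ?_, ?_, ?_⟩
  · intro p; simp [tog, h0]
  · intro t ht
    unfold tog
    by_cases e1 : t = i
    · subst e1; simpa using A.1
    · by_cases e2 : t = i + 1
      · subst e2; simpa using A.2
      · simpa [e1, e2] using h1 t ht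
  · intro t ht
    unfold tog
    by_cases e1 : t = i
    · subst e1; simp; omega
    · by_cases e2 : t = i + 1
      · subst e2; simp; omega
      · simpa [e1, e2, Equiv.swap_apply_of_ne_of_ne e1 e2] using h2 t ht
  · intro t ht
    unfold tog
    rw [if_neg (by omega)]; exact h3 t ht

def ChEq (N n : ℕ) (c c' : ℕ → ℕ) : Prop :=
  ∃ f g : (ℕ → ℕ → ℕ) → (ℕ → ℕ → ℕ),
    (∀ L, IsCh N n c L → IsCh N n c' (f L) ∧ f L n = L n ∧ g (f L) = L) ∧
    (∀ L, IsCh N n c' L → IsCh N n c (g L) ∧ g L n = L n ∧ f (g L) = L)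

lemma ChEq.trans {N n : ℕ} {c c' c'' : ℕ → ℕ} (h : ChEq N n c c') (h' : ChEq N n c' c'') :
    ChEq N n c c'' := by
  obtain ⟨f, g, h1, h2⟩ := h
  obtain ⟨f', g', h1', h2'⟩ := h'
  refine ⟨f' ∘ f, g ∘ g', fun L hL => ?_, fun L hL => ?_⟩
  · obtain ⟨x1, x2, x3⟩ := h1 L hL
    obtain ⟨y1, y2, y3⟩ := h1' _ x1
    exact ⟨y1, y2.trans x2, by simp [y3, x3]⟩
  · obtain ⟨x1, x2, x3⟩ := h2' L hL
    obtain ⟨y1, y2, y3⟩ := h2 _ x1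
    exact ⟨y1, y2.trans x2, by simp [y3, x3]⟩

lemma IsCh.congr {N n : ℕ} {c c' : ℕ → ℕ} (hc : ∀ i < n, c i = c' i) {L : ℕ → ℕ → ℕ}
    (h : IsCh N n c L) : IsCh N n c' L :=
  ⟨h.1, h.2.1, fun i hi => by rw [← hc i hi]; exact h.2.2.1 i hi, h.2.2.2⟩

lemma ChEq.of_congr {N n : ℕ} {c c' : ℕ → ℕ} (hc : ∀ i < n, c i = c' i) : ChEq N n c c' :=
  ⟨id, id, fun _ hL => ⟨hL.congr hc, rfl, rfl⟩,
    fun _ hL => ⟨hL.congr (fun i hi => (hc i hi).symm), rfl, rfl⟩⟩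

lemma ChEq.swap {N n : ℕ} (c : ℕ → ℕ) (hN : n ≤ N) {i : ℕ} (hi : i + 1 < n) :
    ChEq N n c (c ∘ Equiv.swap i (i + 1)) := by
  have hn : ∀ L, tog i L n = L n := by
    intro L; unfold tog; rw [if_neg (by omega)]
  refine ⟨tog i, tog i, fun L hL => ⟨tog_IsCh hL hN hi, hn L, tog_tog hL hi⟩,
    fun L hL => ⟨?_, hn L, tog_tog hL hi⟩⟩
  have := tog_IsCh hL hN hi
  rwa [Function.comp_assoc, ← Equiv.coe_trans, ← Equiv.Perm.mul_def, Equiv.swap_mul_self,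
    Equiv.Perm.coe_one, Function.comp_id] at this

def ext0 (n : ℕ) (c : Fin n → ℕ) (i : ℕ) : ℕ := if h : i < n then c ⟨i, h⟩ else 0

lemma ChEq.perm {N n : ℕ} (hN : n + 1 ≤ N) (σ : Equiv.Perm (Fin (n + 1))) :
    ∀ c : Fin (n + 1) → ℕ, ChEq N (n + 1) (ext0 _ c) (ext0 _ (c ∘ σ)) := by
  have hσ : σ ∈ Submonoid.closure (Set.range fun i : Fin n ↦ Equiv.swap i.castSucc i.succ) := by
    rw [Equiv.Perm.mclosure_swap_castSucc_succ]; trivial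
  induction hσ using Submonoid.closure_induction with
  | mem x hx =>
    obtain ⟨i, rfl⟩ := hx
    intro c
    refine (ChEq.swap (ext0 _ c) hN (i := i) (by omega)).trans (ChEq.of_congr ?_)
    intro t ht
    simp only [Function.comp, ext0, ht, dif_pos]
    by_cases e1 : t = i
    · subst e1
      have : (⟨(i : ℕ), ht⟩ : Fin (n + 1)) = i.castSucc := rfl
      simp [this]
      rfl
    · by_cases e2 : t = i + 1
      · subst e2
        have : (⟨(i : ℕ) + 1, ht⟩ : Fin (n + 1)) = i.succ := rfl
        simp [this]
        rfl
      · rw [Equiv.swap_apply_of_ne_of_ne e1 e2, Equiv.swap_apply_of_ne_of_ne]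
        · simp [ht]
        · simpa [Fin.ext_iff] using e1
        · simpa [Fin.ext_iff] using e2
  | one => intro c; exact ChEq.of_congr (fun _ _ => rfl)
  | mul x y _ _ hx hy => intro c; exact (hx c).trans (hy (c ∘ x))

lemma ChEq.rev {N n : ℕ} (hn : 1 ≤ n) (hN : n ≤ N) (b : ℕ → ℕ) :
    ChEq N n b (fun i => b (n - 1 - i)) := by
  obtain ⟨n, rfl⟩ : ∃ n', n = n' + 1 := ⟨n - 1, by omega⟩
  have := ChEq.perm hN Fin.revPerm (fun i => b i)
  refine ((ChEq.of_congr ?_).trans this).trans (ChEq.of_congr ?_)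
  · intro i hi; simp [ext0, hi]
  · intro i hi; simp [ext0, hi, Fin.val_rev]

lemma Pairs_rev (N k r q : ℕ) (a b : ℕ → ℕ) (hq : 1 ≤ q) (hN : q ≤ N) :
    (Pairs N k r q a b).ncard = (Pairs N k r q a (fun i => b (q - 1 - i))).ncard := by
  obtain ⟨f, g, h1, h2⟩ := ChEq.rev hq hN b
  refine ncard_eq_of (fun x => (x.1, f x.2)) ?_ ?_ ?_
  · rintro ⟨L, R⟩ ⟨hL, hR, hLR, hk⟩
    exact ⟨hL, (h1 R hR).1, by rw [hLR]; exact (h1 R hR).2.1.symm, hk⟩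
  · rintro ⟨L, R⟩ ⟨hL, hR, hLR, hk⟩ ⟨L', R'⟩ ⟨hL', hR', hLR', hk'⟩ h
    simp only [Prod.mk.injEq] at h
    rw [Prod.mk.injEq]
    refine ⟨h.1, ?_⟩
    rw [← (h1 R hR).2.2, ← (h1 R' hR').2.2, h.2]
  · rintro ⟨L, R⟩ ⟨hL, hR, hLR, hk⟩
    exact ⟨(L, g R), ⟨hL, (h2 R hR).1, by rw [hLR]; exact (h2 R hR).2.1.symm, hk⟩,
      by simp [(h2 R hR).2.2]⟩

lemma colLen_inj {μ ν : YoungDiagram} (h : μ.colLen = ν.colLen) : μ = ν := by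
  ext ⟨i, j⟩
  rw [YoungDiagram.mem_cells, YoungDiagram.mem_cells, YoungDiagram.mem_iff_lt_colLen,
    YoungDiagram.mem_iff_lt_colLen, h]

lemma exists_colLen {f : ℕ → ℕ} (hf : Antitone f) {N : ℕ} (hN : ∀ p, N ≤ p → f p = 0) :
    ∃ μ : YoungDiagram, μ.colLen = f := by
  let μ : YoungDiagram :=
    { cells := (Finset.range (f 0) ×ˢ Finset.range N).filter (fun c => c.1 < f c.2)
      isLowerSet := by
        rintro ⟨a1, a2⟩ ⟨b1, b2⟩ hab h
        rw [Prod.mk_le_mk] at hab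
        simp only [Finset.coe_filter, Finset.mem_product, Finset.mem_range,
          Set.mem_ofPred_eq] at h ⊢
        have := hf hab.2
        exact ⟨⟨by omega, by omega⟩, by omega⟩ }
  have hm : ∀ i j, (i, j) ∈ μ ↔ i < f j := by
    intro i j
    rw [← YoungDiagram.mem_cells]
    simp only [μ, Finset.mem_filter, Finset.mem_product, Finset.mem_range]
    constructor
    · exact fun h => h.2
    · intro h
      have := hf (Nat.zero_le j)
      refine ⟨⟨by omega, ?_⟩, h⟩
      by_contra hj
      have := hN j (by omega)
      omega
  refine ⟨μ, ?_⟩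
  funext j
  have : ∀ i, i < μ.colLen j ↔ i < f j := fun i => by
    rw [← YoungDiagram.mem_iff_lt_colLen, hm]
  have h1 := this (f j)
  have h2 := this (μ.colLen j)
  omega

open Classical in
noncomputable def ofCol (f : ℕ → ℕ) : YoungDiagram :=
  if h : ∃ μ : YoungDiagram, μ.colLen = f then h.choose else ⊥

lemma colLen_ofCol {f : ℕ → ℕ} (h : ∃ μ : YoungDiagram, μ.colLen = f) :
    (ofCol f).colLen = f := by
  unfold ofCol
  rw [dif_pos h]; exact h.choose_spec

lemma card_eq_sum_colLen (μ : YoungDiagram) (N : ℕ) (hN : ∀ p, N ≤ p → μ.colLen p = 0) :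
    μ.card = ∑ p ∈ Finset.range N, μ.colLen p := by
  have h := Finset.card_eq_sum_card_fiberwise (s := μ.cells) (t := Finset.range N)
    (f := fun c => c.2) (by
      rintro ⟨i, j⟩ hc
      have hc : (i, j) ∈ μ := hc
      rw [YoungDiagram.mem_iff_lt_colLen] at hc
      simp only [Finset.coe_range, Set.mem_Iio]
      by_contra hj
      have := hN j (by omega)
      omega)
  rw [YoungDiagram.card, h]
  refine Finset.sum_congr rfl fun p _ => ?_
  rw [YoungDiagram.colLen_eq_card]
  rfl

lemma stepSet_iff (τ σ : YoungDiagram) (j : ℕ) :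
    StepSet τ j σ ↔ σ.card + j = τ.card ∧ HS σ.colLen τ.colLen := by
  have ms : ∀ i c, c < σ.rowLen i ↔ i < σ.colLen c := fun i c => by
    rw [← YoungDiagram.mem_iff_lt_colLen, ← YoungDiagram.mem_iff_lt_rowLen]
  have mt : ∀ i c, c < τ.rowLen i ↔ i < τ.colLen c := fun i c => by
    rw [← YoungDiagram.mem_iff_lt_colLen, ← YoungDiagram.mem_iff_lt_rowLen]
  unfold StepSet HS
  refine and_congr_right fun _ => ?_
  constructor
  · intro h p
    constructor
    · by_contra hc
      have h1 := (ms (τ.colLen p) p).2 (by omega)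
      have h2 := (mt (τ.colLen p) p).1 (by have := h (τ.colLen p); omega)
      omega
    · by_contra hc
      have h1 := (mt (σ.colLen p) (p + 1)).2 (by omega)
      have h2 := (ms (σ.colLen p) p).1 (by have := h (σ.colLen p); omega)
      omega
  · intro h i
    constructor
    · by_contra hc
      have h1 := (ms i (τ.rowLen i)).1 (by omega)
      have h2 := (mt i (τ.rowLen i)).2 (by have := h (τ.rowLen i); omega)
      omega
    · by_contra hc
      have h1 := (mt i (σ.rowLen i + 1)).1 (by omega)
      have h2 := (ms i (σ.rowLen i)).2 (by have := h (σ.rowLen i); omega)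
      omega

lemma isColumn_iff (σ : YoungDiagram) (m : ℕ) :
    IsColumn m σ ↔ σ.colLen 0 = m ∧ ∀ p, σ.colLen (p + 1) = 0 := by
  have ms : ∀ i c, c < σ.rowLen i ↔ i < σ.colLen c := fun i c => by
    rw [← YoungDiagram.mem_iff_lt_colLen, ← YoungDiagram.mem_iff_lt_rowLen]
  unfold IsColumn
  constructor
  · intro h
    constructor
    · have h1 := ms m 0
      have h2 := ms (σ.colLen 0) 0
      rw [h] at h1 h2
      split_ifs at h1 h2 <;> omega
    · intro p
      have h1 := ms 0 (p + 1)
      rw [h] at h1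
      split_ifs at h1 <;> omega
  · rintro ⟨h1, h2⟩ i
    have a := ms i 0
    have b := ms i 1
    have := h2 0
    simp only [Nat.zero_add] at this
    split_ifs <;> omega

def RCond (n : ℕ) (A : ℕ → ℕ) (τ : YoungDiagram) (P : Fin (n - 1) → YoungDiagram) : Prop :=
    (∀ i : Fin (n - 1), (i : ℕ) = 0 → StepSet τ (A 0) (P i)) ∧
    (∀ i i' : Fin (n - 1), (i' : ℕ) = (i : ℕ) + 1 → StepSet (P i) (A (i' : ℕ)) (P i')) ∧
    (∀ i : Fin (n - 1), (i : ℕ) = n - 2 → IsColumn (A (n - 1)) (P i))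

def enc (n : ℕ) (τ : YoungDiagram) (P : Fin (n - 1) → YoungDiagram) (t : ℕ) : ℕ → ℕ :=
  if t = n then τ.colLen else if h : 1 ≤ t ∧ t < n then (P ⟨n - 1 - t, by omega⟩).colLen
    else fun _ => 0

lemma enc_IsCh {N n : ℕ} (hn : 2 ≤ n) (hN : n ≤ N) {A : ℕ → ℕ} {τ : YoungDiagram}
    {P : Fin (n - 1) → YoungDiagram} (h : RCond n A τ P) :
    IsCh N n (fun i => A (n - 1 - i)) (enc n τ P) := by
  obtain ⟨h1, h2, h3⟩ := h
  have e0 : ∀ p, enc n τ P 0 p = 0 := by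
    intro p; unfold enc; rw [if_neg (by omega), dif_neg (by omega)]
  have em : ∀ t (h : 1 ≤ t ∧ t < n), enc n τ P t = (P ⟨n - 1 - t, by omega⟩).colLen := by
    intro t h; unfold enc; rw [if_neg (by omega), dif_pos h]
  have en : enc n τ P n = τ.colLen := if_pos rfl
  have key : ∀ t, 1 ≤ t → t < n → ∃ μ ν : YoungDiagram, enc n τ P t = μ.colLen ∧
      enc n τ P (t + 1) = ν.colLen ∧ StepSet ν (A (n - 1 - t)) μ := by
    intro t ht1 ht
    rcases Nat.lt_or_ge (t + 1) n with hlt | hge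
    · exact ⟨_, _, em t ⟨ht1, ht⟩, em (t + 1) ⟨by omega, hlt⟩, h2 _ _ (by simp; omega)⟩
    · obtain rfl : n = t + 1 := by omega
      refine ⟨_, _, em t ⟨ht1, ht⟩, en, ?_⟩
      have := h1 ⟨t + 1 - 1 - t, by omega⟩ (by simp)
      simpa using this
  have hc := (isColumn_iff _ _).1 (h3 ⟨n - 2, by omega⟩ rfl)
  have e1 : enc n τ P 1 = (P ⟨n - 2, by omega⟩).colLen := by
    rw [em 1 (by omega)]; congr 2
  have hHS : ∀ i < n, HS (enc n τ P i) (enc n τ P (i + 1)) := by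
    intro i hi
    rcases Nat.eq_zero_or_pos i with rfl | hp
    · intro p
      rw [Nat.zero_add, e0, e1, hc.2 p]; simp
    · obtain ⟨μ, ν, x1, x2, x3⟩ := key i hp hi
      rw [x1, x2]; exact ((stepSet_iff _ _ _).1 x3).2
  have hs := supp_of_HS e0 hHS
  refine ⟨e0, hHS, ?_, ?_⟩
  · intro i hi
    rcases Nat.eq_zero_or_pos i with rfl | hp
    · rw [Nat.zero_add, e1, Finset.sum_range_succ']
      simp [e0, hc.1, hc.2]
    · obtain ⟨μ, ν, x1, x2, x3⟩ := key i hp hi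
      rw [x1, x2, ← card_eq_sum_colLen, ← card_eq_sum_colLen]
      · exact ((stepSet_iff _ _ _).1 x3).1.symm
      · intro p hp; rw [← x1]; exact hs _ (by omega) _ (by omega)
      · intro p hp; rw [← x2]; exact hs _ (by omega) _ (by omega)
  · intro i hi
    unfold enc; rw [if_neg (by omega), dif_neg (by omega)]

lemma dec_RCond {N n : ℕ} (hn : 2 ≤ n) (hN : n ≤ N) {A : ℕ → ℕ} {L : ℕ → ℕ → ℕ}
    (h : IsCh N n (fun i => A (n - 1 - i)) L) :
    RCond n A (ofCol (L n)) (fun i => ofCol (L (n - 1 - i))) ∧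
      (∀ t ≤ n, (ofCol (L t)).colLen = L t) ∧
      enc n (ofCol (L n)) (fun i => ofCol (L (n - 1 - i))) = L := by
  have hs := supp_of_HS h.1 h.2.1
  obtain ⟨h0, h1, h2, h3⟩ := h
  have hcol : ∀ t ≤ n, (ofCol (L t)).colLen = L t := by
    intro t ht
    apply colLen_ofCol
    refine exists_colLen (antitone_nat_of_succ_le ?_) (hs t ht)
    intro p
    rcases Nat.lt_or_ge t n with h | h
    · have a := h1 t h p
      have b := h1 t h (p + 1)
      omega
    · have a := h1 (t - 1) (by omega) p
      rw [show t - 1 + 1 = t by omega] at a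
      omega
  have hstep : ∀ t < n, StepSet (ofCol (L (t + 1))) (A (n - 1 - t)) (ofCol (L t)) := by
    intro t ht
    rw [stepSet_iff, hcol t ht.le, hcol (t + 1) ht]
    refine ⟨?_, h1 t ht⟩
    rw [card_eq_sum_colLen _ (N + 1), card_eq_sum_colLen _ (N + 1), hcol t ht.le, hcol (t + 1) ht]
    · exact (h2 t ht).symm
    · rw [hcol (t + 1) ht]; intro p hp; exact hs _ (by omega) _ (by omega)
    · rw [hcol t ht.le]; intro p hp; exact hs _ (by omega) _ (by omega)
  refine ⟨⟨?_, ?_, ?_⟩, hcol, ?_⟩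
  · intro i hi
    have := hstep (n - 1) (by omega)
    dsimp only
    rw [hi, Nat.sub_zero]
    rwa [show n - 1 + 1 = n by omega, Nat.sub_self] at this
  · intro i i' hi
    have := hstep (n - 1 - i') (by omega)
    rwa [show n - 1 - i' + 1 = n - 1 - i by omega,
      show n - 1 - (n - 1 - (i' : ℕ)) = i' by omega] at this
  · intro i hi
    dsimp only
    rw [hi, isColumn_iff, hcol _ (by omega), show n - 1 - (n - 2) = 0 + 1 by omega]
    refine ⟨?_, fun p => ?_⟩
    · have := h2 0 (by omega)
      have z : ∀ p, L (0 + 1) (p + 1) = 0 := fun p => hs 1 (by omega) _ (by omega)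
      rw [Finset.sum_range_succ'] at this
      simpa [h0, z] using this
    · exact hs 1 (by omega) _ (by omega)
  · funext t
    unfold enc
    split_ifs with c1 c2
    · rw [c1]; exact hcol n le_rfl
    · dsimp only
      rw [show n - 1 - (n - 1 - t) = t by omega]
      exact hcol t (by omega)
    · rcases Nat.eq_zero_or_pos t with rfl | hp
      · exact (funext h0).symm
      · exact (h3 t (by omega)).symm

lemma IsCh.sum_eq {N n : ℕ} {c : ℕ → ℕ} {L : ℕ → ℕ → ℕ} (h : IsCh N n c L) :
    ∑ p ∈ Finset.range (N + 1), L n p = ∑ i ∈ Finset.range n, c i := by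
  have : ∀ t ≤ n, ∑ p ∈ Finset.range (N + 1), L t p = ∑ i ∈ Finset.range t, c i := by
    intro t
    induction t with
    | zero => intro _; simp [h.1]
    | succ t ih =>
      intro ht
      rw [h.2.2.1 t ht, ih (by omega), Finset.sum_range_succ]
  exact this n le_rfl

lemma card_RSet_eq (N ℓ k r q : ℕ) (A B : ℕ → ℕ) (hr : 2 ≤ r) (hq : 2 ≤ q)
    (hrN : r ≤ N) (hqN : q ≤ N) (hAsum : ∑ i ∈ Finset.range r, A i = ℓ) :
    (RSet ℓ k r q A B).ncard =
      (Pairs N k r q (fun i => A (r - 1 - i)) (fun i => B (q - 1 - i))).ncard := by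
  have en : ∀ n τ P, enc n τ P n = τ.colLen := fun n τ P => if_pos rfl
  refine ncard_eq_of (fun x => (enc r x.2.2 x.1, enc q x.2.2 x.2.1)) ?_ ?_ ?_
  · rintro ⟨P, Q, τ⟩ ⟨h1, h2, h3, h4, h5, h6, h7, h8, h9⟩
    refine ⟨enc_IsCh hr hrN ⟨h4, h5, h6⟩, enc_IsCh hq hqN ⟨h7, h8, h9⟩, ?_, ?_⟩
    · simp only [en]
    · simp only [en]; exact h2
  · have hinj : ∀ n τ (P P' : Fin (n - 1) → YoungDiagram), enc n τ P = enc n τ P' → P = P' := by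
      intro n τ P P' h
      funext i
      have := congrFun h (n - 1 - i)
      have hi := i.2
      unfold enc at this
      rw [if_neg (by omega), dif_pos (by omega), if_neg (by omega), dif_pos (by omega)] at this
      have e : (⟨n - 1 - (n - 1 - i), by omega⟩ : Fin (n - 1)) = i := by
        ext; simp; omega
      rw [e] at this
      exact colLen_inj this
    rintro ⟨P, Q, τ⟩ _ ⟨P', Q', τ'⟩ _ h
    simp only [Prod.mk.injEq] at h
    obtain ⟨ha, hb⟩ := h
    have ht : τ = τ' := by
      have := congrFun ha r
      rw [en, en] at this
      exact colLen_inj this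
    subst ht
    rw [hinj r τ P P' ha, hinj q τ Q Q' hb]
  · rintro ⟨L, R⟩ ⟨hL, hR, hLR, hk⟩
    dsimp only at hL hR hLR hk
    obtain ⟨x1, x2, x3⟩ := dec_RCond hr hrN hL
    obtain ⟨y1, y2, y3⟩ := dec_RCond hq hqN hR
    rw [← hLR] at y1 y3
    have hsL := supp_of_HS hL.1 hL.2.1 r le_rfl
    have hsR := supp_of_HS hR.1 hR.2.1 q le_rfl
    rw [← hLR] at hsR
    refine ⟨(fun i => ofCol (L (r - 1 - i)), fun i => ofCol (R (q - 1 - i)), ofCol (L r)),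
      ⟨?_, ?_, ?_, x1.1, x1.2.1, x1.2.2, y1.1, y1.2.1, y1.2.2⟩, ?_⟩
    · dsimp only
      rw [card_eq_sum_colLen _ (N + 1), x2 r le_rfl, hL.sum_eq, Finset.sum_range_reflect, hAsum]
      rw [x2 r le_rfl]
      intro p hp; exact hsL p (by omega)
    · dsimp only
      rw [x2 r le_rfl]; exact hk
    · dsimp only
      have ms : ∀ c, c < (ofCol (L r)).rowLen 0 ↔ 0 < L r c := fun c => by
        rw [← YoungDiagram.mem_iff_lt_rowLen, YoungDiagram.mem_iff_lt_colLen, x2 r le_rfl]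
      by_contra hc
      have := (ms (min r q)).1 (by omega)
      rcases le_total r q with h | h
      · have := hsL (min r q) (by omega); omega
      · have := hsR (min r q) (by omega); omega
    · simp only [x3, y3]

def ps (A : ℕ → ℕ) (j : ℕ) : ℕ := ∑ i ∈ Finset.range j, A i

lemma ps_succ (A : ℕ → ℕ) (j : ℕ) : ps A (j + 1) = ps A j + A j := Finset.sum_range_succ _ _

lemma ps_mono (A : ℕ → ℕ) : Monotone (ps A) :=
  monotone_nat_of_le_succ fun j => by rw [ps_succ]; omega

lemma mem_Block (A : ℕ → ℕ) (j p : ℕ) : p ∈ Block A j ↔ ps A j < p ∧ p ≤ ps A (j + 1) := by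
  unfold Block ps; rw [Finset.mem_Ioc]

lemma Block_lt {A : ℕ → ℕ} {i j p p' : ℕ} (hp : p ∈ Block A i) (hp' : p' ∈ Block A j)
    (h : i < j) : p < p' := by
  rw [mem_Block] at hp hp'
  have := ps_mono A (show i + 1 ≤ j by omega)
  omega

lemma Block_unique {A : ℕ → ℕ} {i j p : ℕ} (hp : p ∈ Block A i) (hp' : p ∈ Block A j) :
    i = j := by
  rcases lt_trichotomy i j with h | h | h
  · exact absurd (Block_lt hp hp' h) (lt_irrefl _)
  · exact h
  · exact absurd (Block_lt hp' hp h) (lt_irrefl _)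

lemma exists_Block (A : ℕ → ℕ) (r p : ℕ) (h1 : 1 ≤ p) (h2 : p ≤ ps A r) :
    ∃ i < r, p ∈ Block A i := by
  induction r with
  | zero => simp [ps] at h2; omega
  | succ r ih =>
    rcases Nat.lt_or_ge (ps A r) p with h | h
    · exact ⟨r, by omega, (mem_Block _ _ _).2 ⟨h, h2⟩⟩
    · obtain ⟨i, hi, hp⟩ := ih h
      exact ⟨i, by omega, hp⟩

lemma Block_sub {A : ℕ → ℕ} {i r p : ℕ} (hi : i < r) (hp : p ∈ Block A i) :
    1 ≤ p ∧ p ≤ ps A r := by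
  rw [mem_Block] at hp
  have := ps_mono A (show i + 1 ≤ r by omega)
  omega

lemma card_Block (A : ℕ → ℕ) (i : ℕ) : (Block A i).card = A i := by
  unfold Block
  rw [Nat.card_Ioc, Finset.sum_range_succ]; omega

open Classical in
noncomputable def bidx (A : ℕ → ℕ) (r p : ℕ) : ℕ :=
  if h : ∃ i < r, p ∈ Block A i then h.choose else 0

lemma bidx_spec {A : ℕ → ℕ} {r p : ℕ} (h1 : 1 ≤ p) (h2 : p ≤ ps A r) :
    bidx A r p < r ∧ p ∈ Block A (bidx A r p) := by
  unfold bidx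
  have h := exists_Block A r p h1 h2
  rw [dif_pos h]; exact h.choose_spec

lemma bidx_eq {A : ℕ → ℕ} {r p i : ℕ} (hi : i < r) (hp : p ∈ Block A i) : bidx A r p = i := by
  obtain ⟨h1, h2⟩ := Block_sub hi hp
  exact Block_unique (bidx_spec h1 h2).2 hp

lemma card_Icc_filter_Block (A : ℕ → ℕ) (r : ℕ) (P : ℕ → Prop) [DecidablePred P] :
    ((Finset.Icc 1 (ps A r)).filter P).card =
      ∑ j ∈ Finset.range r, ((Block A j).filter P).card := by
  induction r with
  | zero => simp [ps]
  | succ r ih =>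
    rw [Finset.sum_range_succ, ← ih, ← Finset.card_union_of_disjoint, ← Finset.filter_union]
    · congr 2
      ext p
      have := ps_mono A (show r ≤ r + 1 by omega)
      simp only [Finset.mem_union, Finset.mem_Icc, mem_Block]
      omega
    · rw [Finset.disjoint_left]
      intro p hp hp'
      simp only [Finset.mem_filter, Finset.mem_Icc, mem_Block] at hp hp'
      omega

def Wd (ℓ k r q : ℕ) (a B : ℕ → ℕ) : Set (ℕ → ℕ) :=
  {g | (∀ p, p ∉ Finset.Icc 1 ℓ → g p = 0) ∧ (∀ p ∈ Finset.Icc 1 ℓ, g p < r) ∧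
    (∀ i < r, ((Finset.Icc 1 ℓ).filter (fun p => g p = i)).card = a i) ∧
    (∀ j < q, ∀ p₁ ∈ Block B j, ∀ p₂ ∈ Block B j, p₁ < p₂ → g p₁ ≤ g p₂) ∧
    (∀ S : Finset ℕ, S ⊆ Finset.Icc 1 ℓ → MonotoneOn g S → S.card ≤ k)}

def matOf (r q : ℕ) (B g : ℕ → ℕ) (i j : ℕ) : ℕ :=
  if i < r ∧ j < q then ((Block B j).filter (fun p => g p = i)).card else 0

lemma lpp_upper (r q : ℕ) (B g : ℕ → ℕ) :
    ∀ i ≤ r, ∀ j ≤ q, ∀ S : Finset ℕ, S ⊆ Finset.Icc 1 (ps B j) → (∀ p ∈ S, g p < i) →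
      MonotoneOn g S → S.card ≤ Lam (matOf r q B g) i j 0 := by
  intro i
  induction i with
  | zero =>
    intro _ j _ S _ h _
    have : S = ∅ := Finset.eq_empty_of_forall_notMem fun p hp => by have := h p hp; omega
    simp [this]
  | succ i ihi =>
    intro hi j
    induction j with
    | zero =>
      intro _ S hS _ _
      simp [ps] at hS
      simp [hS]
    | succ j ihj =>
      intro hj S hS hg hm
      rw [Lam_succ]
      have hmat : matOf r q B g i j = ((Block B j).filter (fun p => g p = i)).card :=
        if_pos ⟨by omega, by omega⟩
      simp only [fstep]
      rw [hmat]
      set V := (Block B j).filter (fun p => g p = i) with hV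
      have hmV : ∀ p, p ∈ V ↔ (ps B j < p ∧ p ≤ ps B (j + 1)) ∧ g p = i := by
        intro p; rw [hV, Finset.mem_filter, mem_Block]
      have h1 : S.card ≤ (S \ V).card + V.card := by
        have := Finset.le_card_sdiff V S
        omega
      have hm' : MonotoneOn g ↑(S \ V) := hm.mono (by simp)
      have h2 : (S \ V).card ≤ Lam (matOf r q B g) i (j + 1) 0 ∨
          (S \ V).card ≤ Lam (matOf r q B g) (i + 1) j 0 := by
        by_cases hc : ∀ p ∈ S \ V, g p < i
        · left
          exact ihi (by omega) (j + 1) hj _ (Finset.sdiff_subset.trans hS) hc hm'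
        · right
          push Not at hc
          obtain ⟨p', hp', hgp'⟩ := hc
          refine ihj (by omega) _ ?_ (fun p hp => hg p (Finset.mem_sdiff.1 hp).1) hm'
          intro p hp
          have a1 := hg p (Finset.mem_sdiff.1 hp).1
          have a2 := hg p' (Finset.mem_sdiff.1 hp').1
          have b1 := Finset.mem_Icc.1 (hS (Finset.mem_sdiff.1 hp).1)
          have b2 := Finset.mem_Icc.1 (hS (Finset.mem_sdiff.1 hp').1)
          have c1 := (Finset.mem_sdiff.1 hp).2
          have c2 := (Finset.mem_sdiff.1 hp').2
          rw [hmV] at c1 c2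
          rw [Finset.mem_Icc]
          refine ⟨b1.1, ?_⟩
          by_contra hlt
          have h3 : p' < p := by omega
          have h4 := hm' (Finset.mem_coe.2 hp') (Finset.mem_coe.2 hp) h3.le
          omega
      omega

lemma lpp_lower (r q : ℕ) (B g : ℕ → ℕ)
    (hB : ∀ j < q, ∀ p₁ ∈ Block B j, ∀ p₂ ∈ Block B j, p₁ < p₂ → g p₁ ≤ g p₂) :
    ∀ i ≤ r, ∀ j ≤ q, ∃ S : Finset ℕ, S ⊆ Finset.Icc 1 (ps B j) ∧ (∀ p ∈ S, g p < i) ∧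
      MonotoneOn g S ∧ S.card = Lam (matOf r q B g) i j 0 := by
  intro i
  induction i with
  | zero => intro _ j _; exact ⟨∅, by simp, by simp, by simp [MonotoneOn], by simp [Lam_zero_left]⟩
  | succ i ihi =>
    intro hi j
    induction j with
    | zero => intro _; exact ⟨∅, by simp, by simp, by simp [MonotoneOn], by simp [Lam_zero_right]⟩
    | succ j ihj =>
      intro hj
      rw [Lam_succ]
      have hmat : matOf r q B g i j = ((Block B j).filter (fun p => g p = i)).card :=
        if_pos ⟨by omega, by omega⟩
      simp only [fstep]
      rw [hmat]
      set V := (Block B j).filter (fun p => g p = i) with hV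
      have hmV : ∀ p, p ∈ V ↔ (ps B j < p ∧ p ≤ ps B (j + 1)) ∧ g p = i := by
        intro p; rw [hV, Finset.mem_filter, mem_Block]
      have hps := ps_mono B (show j ≤ j + 1 by omega)
      have main : ∀ S : Finset ℕ, S ⊆ Finset.Icc 1 (ps B (j + 1)) → (∀ p ∈ S, g p < i + 1) →
          MonotoneOn g S → Disjoint S V → ∃ S' : Finset ℕ, S' ⊆ Finset.Icc 1 (ps B (j + 1)) ∧
            (∀ p ∈ S', g p < i + 1) ∧ MonotoneOn g S' ∧ S'.card = S.card + V.card := by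
        intro S h1 h2 h3 h4
        refine ⟨S ∪ V, ?_, ?_, ?_, Finset.card_union_of_disjoint h4⟩
        · refine Finset.union_subset h1 fun p hp => ?_
          rw [hmV] at hp
          rw [Finset.mem_Icc]; omega
        · intro p hp
          rcases Finset.mem_union.1 hp with h | h
          · exact h2 p h
          · rw [hmV] at h; omega
        · intro p hp p' hp' hpp
          rcases Finset.mem_union.1 (Finset.mem_coe.1 hp) with h | h <;>
            rcases Finset.mem_union.1 (Finset.mem_coe.1 hp') with h' | h'
          · exact h3 h h' hpp
          · have := h2 p h
            rw [hmV] at h'; omega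
          · rcases hpp.eq_or_lt with e | e
            · rw [e]
            · rw [hmV] at h
              have := Finset.mem_Icc.1 (h1 h')
              exact hB j (by omega) p ((mem_Block _ _ _).2 h.1) p'
                ((mem_Block _ _ _).2 (by omega)) e
          · rw [hmV] at h h'; omega
      obtain ⟨S1, a1, a2, a3, a4⟩ := ihi (by omega) (j + 1) hj
      obtain ⟨S2, b1, b2, b3, b4⟩ := ihj (by omega)
      rw [← a4, ← b4]
      rcases le_total S1.card S2.card with hle | hle
      · rw [max_eq_right hle]
        refine main S2 ?_ b2 b3 ?_
        · intro p hp
          have := Finset.mem_Icc.1 (b1 hp)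
          rw [Finset.mem_Icc]; omega
        · rw [Finset.disjoint_left]
          intro p hp hp'
          have := Finset.mem_Icc.1 (b1 hp)
          rw [hmV] at hp'; omega
      · rw [max_eq_left hle]
        refine main S1 a1 (fun p hp => by have := a2 p hp; omega) a3 ?_
        rw [Finset.disjoint_left]
        intro p hp hp'
        have := a2 p hp
        rw [hmV] at hp'; omega

lemma card_le_filter (V : Finset ℕ) (g : ℕ → ℕ) (i : ℕ) :
    (V.filter (fun p => g p < i)).card =
      ∑ i' ∈ Finset.range i, (V.filter (fun p => g p = i')).card := by
  rw [Finset.card_eq_sum_card_fiberwise (f := g) (t := Finset.range i)]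
  · refine Finset.sum_congr rfl fun i' hi' => ?_
    rw [Finset.filter_filter]
    congr 1
    ext p
    simp only [Finset.mem_filter]
    rw [Finset.mem_range] at hi'
    constructor
    · rintro ⟨h, h1, h2⟩; exact ⟨h, h2⟩
    · rintro ⟨h, h1⟩; exact ⟨h, by omega, h1⟩
  · intro p hp
    simpa using (Finset.mem_filter.1 (Finset.mem_coe.1 hp)).2

lemma matOf_inj_aux (r q : ℕ) (B g g' : ℕ → ℕ)
    (hB : ∀ j < q, ∀ p₁ ∈ Block B j, ∀ p₂ ∈ Block B j, p₁ < p₂ → g p₁ ≤ g p₂)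
    (hB' : ∀ j < q, ∀ p₁ ∈ Block B j, ∀ p₂ ∈ Block B j, p₁ < p₂ → g' p₁ ≤ g' p₂)
    (h : matOf r q B g = matOf r q B g') (j : ℕ) (hj : j < q) (p : ℕ) (hp : p ∈ Block B j)
    (hr : g p < r) : g' p ≤ g p := by
  by_contra hlt
  have e : ((Block B j).filter (fun x => g x < g p + 1)).card =
      ((Block B j).filter (fun x => g' x < g p + 1)).card := by
    rw [card_le_filter, card_le_filter]
    refine Finset.sum_congr rfl fun i hi => ?_
    rw [Finset.mem_range] at hi
    have := congrFun (congrFun h i) j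
    unfold matOf at this
    rwa [if_pos ⟨by omega, hj⟩, if_pos ⟨by omega, hj⟩] at this
  have hp1 := (mem_Block _ _ _).1 hp
  have h1 : (Finset.Ioc (ps B j) p).card ≤ ((Block B j).filter (fun x => g x < g p + 1)).card := by
    refine Finset.card_le_card fun x hx => ?_
    rw [Finset.mem_Ioc] at hx
    have hxB : x ∈ Block B j := (mem_Block _ _ _).2 (by omega)
    rw [Finset.mem_filter]
    refine ⟨hxB, ?_⟩
    rcases hx.2.eq_or_lt with e | e
    · rw [e]; omega
    · have := hB j hj x hxB p hp e; omega
  have h2 : ((Block B j).filter (fun x => g' x < g p + 1)).card ≤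
      (Finset.Ioc (ps B j) (p - 1)).card := by
    refine Finset.card_le_card fun x hx => ?_
    rw [Finset.mem_filter] at hx
    have hxB := (mem_Block _ _ _).1 hx.1
    rw [Finset.mem_Ioc]
    refine ⟨hxB.1, ?_⟩
    by_contra hc
    have : p ≤ x := by omega
    rcases this.eq_or_lt with e | e
    · rw [← e] at hx; omega
    · have := hB' j hj p hp x hx.1 e; omega
  rw [Nat.card_Ioc] at h1 h2
  omega

lemma card_Wd_eq (ℓ k r q : ℕ) (a B : ℕ → ℕ) (hB : ps B q = ℓ) :
    (Wd ℓ k r q a B).ncard = (Mat k r q a B).ncard := by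
  refine ncard_eq_of (matOf r q B) ?_ ?_ ?_
  · rintro g ⟨h1, h2, h3, h4, h5⟩
    refine ⟨fun i j h => if_neg h, ?_, ?_, ?_⟩
    · intro i hi
      rw [← h3 i hi, ← hB, card_Icc_filter_Block]
      refine Finset.sum_congr rfl fun j hj => ?_
      exact if_pos ⟨hi, Finset.mem_range.1 hj⟩
    · intro j hj
      rw [← card_Block B j]
      have : Block B j = (Block B j).filter (fun p => g p < r) := by
        rw [Finset.filter_true_of_mem]
        intro p hp
        have := Block_sub hj hp
        exact h2 p (Finset.mem_Icc.2 (by omega))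
      rw [this, card_le_filter]
      refine Finset.sum_congr rfl fun i hi => ?_
      exact if_pos ⟨Finset.mem_range.1 hi, hj⟩
    · obtain ⟨S, s1, s2, s3, s4⟩ := lpp_lower r q B g h4 r le_rfl q le_rfl
      rw [← s4]
      rw [hB] at s1
      exact h5 S s1 s3
  · rintro g ⟨h1, h2, h3, h4, h5⟩ g' ⟨h1', h2', h3', h4', h5'⟩ h
    funext p
    by_cases hp : p ∈ Finset.Icc 1 ℓ
    · have hp' := Finset.mem_Icc.1 hp
      obtain ⟨j, hj, hpj⟩ := exists_Block B q p hp'.1 (by omega)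
      exact le_antisymm (matOf_inj_aux r q B g' g h4' h4 h.symm j hj p hpj (h2' p hp))
        (matOf_inj_aux r q B g g' h4 h4' h j hj p hpj (h2 p hp))
    · rw [h1 p hp, h1' p hp]
  · rintro m ⟨m0, m1, m2, m3⟩
    let g : ℕ → ℕ := fun p => if p ∈ Finset.Icc 1 ℓ then
      bidx (fun i => m i (bidx B q p)) r (p - ps B (bidx B q p)) else 0
    have gspec : ∀ j < q, ∀ p ∈ Block B j, g p < r ∧
        p - ps B j ∈ Block (fun i => m i j) (g p) := by
      intro j hj p hp
      have hb := Block_sub hj hp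
      have : g p = bidx (fun i => m i j) r (p - ps B j) := by
        simp only [g]
        rw [if_pos (Finset.mem_Icc.2 (by omega)), bidx_eq hj hp]
      rw [this]
      have hp' := (mem_Block _ _ _).1 hp
      apply bidx_spec (by omega)
      unfold ps at *
      rw [m2 j hj]
      rw [Finset.sum_range_succ] at hp'
      omega
    have gblock : ∀ j < q, ∀ i < r, ((Block B j).filter (fun p => g p = i)).card = m i j := by
      intro j hj i hi
      have e : (Block B j).filter (fun p => g p = i) =
        Finset.Ioc (ps B j + ps (fun i => m i j) i) (ps B j + ps (fun i => m i j) (i + 1)) := by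
        ext p
        rw [Finset.mem_filter, Finset.mem_Ioc]
        constructor
        · rintro ⟨hp, rfl⟩
          have := (gspec j hj p hp).2
          rw [mem_Block] at this
          omega
        · intro hp
          have hlt := ps_mono (fun i => m i j) (show i + 1 ≤ r by omega)
          have hr : ps (fun i => m i j) r = B j := m2 j hj
          have hpB : p ∈ Block B j := by
            rw [mem_Block, ps_succ]; omega
          refine ⟨hpB, ?_⟩
          refine Block_unique (gspec j hj p hpB).2 ?_
          rw [mem_Block]; omega
      rw [e, Nat.card_Ioc, ps_succ]; omega
    have gmat : matOf r q B g = m := by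
      funext i j
      unfold matOf
      split_ifs with h
      · exact gblock j h.2 i h.1
      · exact (m0 i j h).symm
    have grng : ∀ p ∈ Finset.Icc 1 ℓ, g p < r := by
      intro p hp
      rw [Finset.mem_Icc] at hp
      obtain ⟨j, hj, hpj⟩ := exists_Block B q p hp.1 (by omega)
      exact (gspec j hj p hpj).1
    refine ⟨g, ⟨fun p hp => if_neg hp, grng, ?_, ?_, ?_⟩, gmat⟩
    · intro i hi
      rw [← hB, card_Icc_filter_Block, ← m1 i hi]
      exact Finset.sum_congr rfl fun j hj => gblock j (Finset.mem_range.1 hj) i hi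
    · intro j hj p1 hp1 p2 hp2 hlt
      by_contra hc
      have := Block_lt (gspec j hj p2 hp2).2 (gspec j hj p1 hp1).2 (by omega)
      omega
    · intro S hS hm
      rw [← gmat] at m3
      refine le_trans (lpp_upper r q B g r le_rfl q le_rfl S (by rwa [hB]) ?_ hm) m3
      intro p hp; exact grng p (hS hp)

def rankW (ℓ : ℕ) (g : ℕ → ℕ) (p : ℕ) : ℕ :=
  if p ∈ Finset.Icc 1 ℓ then
    ((Finset.Icc 1 ℓ).filter (fun p' => g p < g p' ∨ (g p = g p' ∧ p ≤ p'))).card else p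

lemma rankW_lt {ℓ : ℕ} {g : ℕ → ℕ} {p₁ p₂ : ℕ} (h1 : p₁ ∈ Finset.Icc 1 ℓ)
    (h2 : p₂ ∈ Finset.Icc 1 ℓ) (h : g p₁ < g p₂ ∨ (g p₁ = g p₂ ∧ p₁ < p₂)) :
    rankW ℓ g p₂ < rankW ℓ g p₁ := by
  unfold rankW
  rw [if_pos h1, if_pos h2]
  apply Finset.card_lt_card
  rw [Finset.ssubset_iff_of_subset]
  · refine ⟨p₁, ?_, ?_⟩
    · rw [Finset.mem_filter]; exact ⟨h1, by omega⟩
    · rw [Finset.mem_filter]; rintro ⟨_, h'⟩; omega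
  · intro p hp
    rw [Finset.mem_filter] at hp ⊢
    exact ⟨hp.1, by omega⟩

lemma rel_iff {ℓ : ℕ} {g w : ℕ → ℕ}
    (h : ∀ p₁ ∈ Finset.Icc 1 ℓ, ∀ p₂ ∈ Finset.Icc 1 ℓ,
      (g p₁ < g p₂ ∨ (g p₁ = g p₂ ∧ p₁ < p₂)) → w p₂ < w p₁) :
    ∀ p₁ ∈ Finset.Icc 1 ℓ, ∀ p₂ ∈ Finset.Icc 1 ℓ,
      (w p₂ < w p₁ ↔ (g p₁ < g p₂ ∨ (g p₁ = g p₂ ∧ p₁ < p₂))) := by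
  intro p₁ h1 p₂ h2
  refine ⟨fun hlt => ?_, h p₁ h1 p₂ h2⟩
  by_contra hc
  have : (g p₂ < g p₁ ∨ (g p₂ = g p₁ ∧ p₂ < p₁)) ∨ p₁ = p₂ := by omega
  rcases this with h3 | h3
  · have := h p₂ h2 p₁ h1 h3; omega
  · subst h3; omega

lemma avoid_iff {ℓ k : ℕ} {g w : ℕ → ℕ}
    (h : ∀ p₁ ∈ Finset.Icc 1 ℓ, ∀ p₂ ∈ Finset.Icc 1 ℓ,
      (w p₂ < w p₁ ↔ (g p₁ < g p₂ ∨ (g p₁ = g p₂ ∧ p₁ < p₂)))) :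
    (∀ s : Fin (k + 1) → ℕ, StrictMono s → (∀ i, s i ∈ Set.Icc 1 ℓ) →
      ¬ StrictAnti (fun i => w (s i))) ↔
    (∀ S : Finset ℕ, S ⊆ Finset.Icc 1 ℓ → MonotoneOn g S → S.card ≤ k) := by
  constructor
  · intro H S hS hm
    by_contra hc
    obtain ⟨S', hS', hcard⟩ := Finset.exists_subset_card_eq (show k + 1 ≤ S.card by omega)
    have hmem : ∀ i, S'.orderEmbOfFin hcard i ∈ S := fun i =>
      hS' (Finset.orderEmbOfFin_mem S' hcard i)
    refine H (S'.orderEmbOfFin hcard) (S'.orderEmbOfFin hcard).strictMono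
      (fun i => by simpa using hS (hmem i)) ?_
    intro i j hij
    have hlt := (S'.orderEmbOfFin hcard).strictMono hij
    have := hm (Finset.mem_coe.2 (hmem i)) (Finset.mem_coe.2 (hmem j)) hlt.le
    refine (h _ (hS (hmem i)) _ (hS (hmem j))).2 ?_
    omega
  · intro H s hs hI ha
    have := H (Finset.univ.image s) ?_ ?_
    · rw [Finset.card_image_of_injective _ hs.injective, Finset.card_fin] at this
      omega
    · intro p hp
      obtain ⟨i, -, rfl⟩ := Finset.mem_image.1 hp
      simpa using hI i
    · intro p hp p' hp' hpp
      obtain ⟨i, -, rfl⟩ := Finset.mem_image.1 (Finset.mem_coe.1 hp)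
      obtain ⟨j, -, rfl⟩ := Finset.mem_image.1 (Finset.mem_coe.1 hp')
      rcases (hs.le_iff_le.1 hpp).eq_or_lt with e | e
      · rw [e]
      · have := (h (s i) (by simpa using hI i) (s j) (by simpa using hI j)).1 (ha e)
        omega

lemma card_filter_bij {ℓ : ℕ} {w : ℕ → ℕ} (hw : Set.BijOn w (Set.Icc 1 ℓ) (Set.Icc 1 ℓ))
    (T : Finset ℕ) (hT : T ⊆ Finset.Icc 1 ℓ) :
    ((Finset.Icc 1 ℓ).filter (fun p => w p ∈ T)).card = T.card := by
  have : ((Finset.Icc 1 ℓ).filter (fun p => w p ∈ T)).image w = T := by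
    ext v
    rw [Finset.mem_image]
    constructor
    · rintro ⟨p, hp, rfl⟩; exact (Finset.mem_filter.1 hp).2
    · intro hv
      have hv' := hT hv
      obtain ⟨p, hp, rfl⟩ := hw.surjOn (show v ∈ Set.Icc 1 ℓ by simpa using hv')
      exact ⟨p, Finset.mem_filter.2 ⟨by simpa using hp, hv⟩, rfl⟩
  rw [← this, Finset.card_image_of_injOn, this]
  intro p hp p' hp' h
  refine hw.injOn ?_ ?_ h
  · simpa using (Finset.mem_filter.1 (Finset.mem_coe.1 hp)).1
  · simpa using (Finset.mem_filter.1 (Finset.mem_coe.1 hp')).1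

lemma card_ge_filter {ℓ r : ℕ} {A g : ℕ → ℕ} (h2 : ∀ p ∈ Finset.Icc 1 ℓ, g p < r)
    (h3 : ∀ i < r, ((Finset.Icc 1 ℓ).filter (fun p => g p = i)).card = A (r - 1 - i)) :
    ∀ t ≤ r, ((Finset.Icc 1 ℓ).filter (fun p => r - t ≤ g p)).card = ps A t := by
  intro t
  induction t with
  | zero =>
    intro _
    rw [Finset.filter_false_of_mem]
    · simp [ps]
    · intro p hp; have := h2 p hp; omega
  | succ t ih =>
    intro ht
    have e := h3 (r - 1 - t) (by omega)
    rw [show r - 1 - (r - 1 - t) = t by omega] at e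
    rw [ps_succ, ← ih (by omega), ← e, ← Finset.card_union_of_disjoint, ← Finset.filter_or]
    · congr 1
      ext p
      simp only [Finset.mem_filter]
      refine and_congr_right fun _ => ?_
      omega
    · rw [Finset.disjoint_left]
      intro p hp hp'
      rw [Finset.mem_filter] at hp hp'
      omega

lemma rankW_block {ℓ r : ℕ} {A g : ℕ → ℕ} (h2 : ∀ p ∈ Finset.Icc 1 ℓ, g p < r)
    (h3 : ∀ i < r, ((Finset.Icc 1 ℓ).filter (fun p => g p = i)).card = A (r - 1 - i))
    (p : ℕ) (hp : p ∈ Finset.Icc 1 ℓ) : rankW ℓ g p ∈ Block A (r - 1 - g p) := by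
  have hg := h2 p hp
  rw [mem_Block, ← card_ge_filter h2 h3 _ (by omega), ← card_ge_filter h2 h3 _ (by omega)]
  unfold rankW
  rw [if_pos hp]
  constructor
  · apply Finset.card_lt_card
    rw [Finset.ssubset_iff_of_subset]
    · refine ⟨p, ?_, ?_⟩
      · rw [Finset.mem_filter]; exact ⟨hp, by omega⟩
      · rw [Finset.mem_filter]; rintro ⟨_, h'⟩; omega
    · intro x hx
      rw [Finset.mem_filter] at hx ⊢
      exact ⟨hx.1, by omega⟩
  · apply Finset.card_le_card
    intro x hx
    rw [Finset.mem_filter] at hx ⊢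
    exact ⟨hx.1, by omega⟩

lemma card_W_eq (ℓ k r q : ℕ) (A B : ℕ → ℕ) (hA : ps A r = ℓ) (hB : ps B q = ℓ) :
    (Wd ℓ k r q (fun i => A (r - 1 - i)) B).ncard = (WSet ℓ k r q A B).ncard := by
  refine ncard_eq_of (rankW ℓ) ?_ ?_ ?_
  · rintro g ⟨h1, h2, h3, h4, h5⟩
    have rel := rel_iff (ℓ := ℓ) (g := g) (w := rankW ℓ g)
      (fun p₁ hp₁ p₂ hp₂ h => rankW_lt hp₁ hp₂ h)
    have blk := rankW_block h2 h3
    have hmaps : ∀ p ∈ Finset.Icc 1 ℓ, rankW ℓ g p ∈ Finset.Icc 1 ℓ := by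
      intro p hp
      have := Block_sub (r := r) (by have := h2 p hp; omega) (blk p hp)
      rw [Finset.mem_Icc]; omega
    have hinj : ∀ p ∈ Finset.Icc 1 ℓ, ∀ p' ∈ Finset.Icc 1 ℓ,
        rankW ℓ g p = rankW ℓ g p' → p = p' := by
      intro p hp p' hp' h
      have a := rel p hp p' hp'
      have b := rel p' hp' p hp
      omega
    refine ⟨?_, fun p hp => if_neg (by simpa using hp), (avoid_iff rel).2 h5, ?_, ?_⟩
    · have hm : Set.MapsTo (rankW ℓ g) (Set.Icc 1 ℓ) (Set.Icc 1 ℓ) := by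
        intro p hp
        have := hmaps p (by simpa using hp)
        simpa using this
      have hi : Set.InjOn (rankW ℓ g) (Set.Icc 1 ℓ) := by
        intro p hp p' hp' h
        exact hinj p (by simpa using hp) p' (by simpa using hp') h
      refine ⟨hm, hi, ?_⟩
      have := Finset.surjOn_of_injOn_of_card_le (s := Finset.Icc 1 ℓ) (t := Finset.Icc 1 ℓ)
        (rankW ℓ g) (by simpa using hm) (by simpa using hi) le_rfl
      simpa using this
    · intro j hj m₁ hm₁ m₂ hm₂ hlt p₁ hp₁ p₂ hp₂ e₁ e₂
      have hp₁' : p₁ ∈ Finset.Icc 1 ℓ := by simpa using hp₁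
      have hp₂' : p₂ ∈ Finset.Icc 1 ℓ := by simpa using hp₂
      subst e₁ e₂
      have x1 := Block_unique (blk p₁ hp₁') hm₁
      have x2 := Block_unique (blk p₂ hp₂') hm₂
      have y1 := h2 p₁ hp₁'
      have y2 := h2 p₂ hp₂'
      have := (rel p₂ hp₂' p₁ hp₁').1 hlt
      omega
    · intro j hj p₁ hp₁ p₂ hp₂ hlt
      have b1 := Block_sub hj hp₁
      have b2 := Block_sub hj hp₂
      rw [hB] at b1 b2
      have := h4 j hj p₁ hp₁ p₂ hp₂ hlt
      exact (rel p₁ (Finset.mem_Icc.2 b1) p₂ (Finset.mem_Icc.2 b2)).2 (by omega)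
  · rintro g ⟨h1, h2, h3, h4, h5⟩ g' ⟨h1', h2', h3', h4', h5'⟩ h
    funext p
    by_cases hp : p ∈ Finset.Icc 1 ℓ
    · have a := rankW_block h2 h3 p hp
      have b := rankW_block h2' h3' p hp
      rw [h] at a
      have := Block_unique a b
      have := h2 p hp
      have := h2' p hp
      omega
    · rw [h1 p hp, h1' p hp]
  · rintro w ⟨w1, w2, w3, w4, w5⟩
    let g : ℕ → ℕ := fun p => if p ∈ Finset.Icc 1 ℓ then r - 1 - bidx A r (w p) else 0
    have wI : ∀ p ∈ Finset.Icc 1 ℓ, 1 ≤ w p ∧ w p ≤ ℓ := by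
      intro p hp
      have := w1.mapsTo (show p ∈ Set.Icc 1 ℓ by simpa using hp)
      simpa using this
    have gspec : ∀ p ∈ Finset.Icc 1 ℓ, g p < r ∧ w p ∈ Block A (r - 1 - g p) := by
      intro p hp
      have hg : g p = r - 1 - bidx A r (w p) := if_pos hp
      have hw := wI p hp
      have hb := bidx_spec (A := A) (r := r) hw.1 (by omega)
      rw [hg]
      refine ⟨by omega, ?_⟩
      rw [show r - 1 - (r - 1 - bidx A r (w p)) = bidx A r (w p) by omega]
      exact hb.2
    have rel := rel_iff (ℓ := ℓ) (g := g) (w := w) (by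
      intro p₁ hp₁ p₂ hp₂ h
      have a1 := gspec p₁ hp₁
      have a2 := gspec p₂ hp₂
      rcases h with h | ⟨h, h'⟩
      · exact Block_lt a2.2 a1.2 (by omega)
      · by_contra hc
        have hne : w p₁ ≠ w p₂ := by
          intro e
          have := w1.injOn (show p₁ ∈ Set.Icc 1 ℓ by simpa using hp₁)
            (show p₂ ∈ Set.Icc 1 ℓ by simpa using hp₂) e
          omega
        rw [← h] at a2
        have := w4 (r - 1 - g p₁) (by omega) _ a1.2 _ a2.2 (by omega) p₁ (by simpa using hp₁)
          p₂ (by simpa using hp₂) rfl rfl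
        omega)
    refine ⟨g, ⟨fun p hp => if_neg hp, fun p hp => (gspec p hp).1, ?_, ?_,
      (avoid_iff rel).1 w3⟩, ?_⟩
    · intro i hi
      dsimp only
      rw [← card_Block A (r - 1 - i), ← card_filter_bij w1 (Block A (r - 1 - i))]
      · congr 1
        ext p
        simp only [Finset.mem_filter]
        refine and_congr_right fun hp => ?_
        have := gspec p hp
        constructor
        · rintro rfl; exact this.2
        · intro h
          have := Block_unique this.2 h
          omega
      · intro x hx
        have := Block_sub (r := r) (by omega) hx
        rw [Finset.mem_Icc]; omega
    · intro j hj p₁ hp₁ p₂ hp₂ hlt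
      have b1 := Block_sub hj hp₁
      have b2 := Block_sub hj hp₂
      rw [hB] at b1 b2
      have := (rel p₁ (Finset.mem_Icc.2 b1) p₂ (Finset.mem_Icc.2 b2)).1 (w5 j hj p₁ hp₁ p₂ hp₂ hlt)
      omega
    · funext p
      by_cases hp : p ∈ Finset.Icc 1 ℓ
      · have hw := wI p hp
        have e := card_filter_bij w1 (Finset.Icc 1 (w p)) (by
          intro x hx; rw [Finset.mem_Icc] at hx ⊢; omega)
        rw [Nat.card_Icc] at e
        have e2 : rankW ℓ g p = ((Finset.Icc 1 ℓ).filter (fun p' => w p' ∈ Finset.Icc 1 (w p))).card := by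
          unfold rankW
          rw [if_pos hp]
          congr 1
          ext p'
          simp only [Finset.mem_filter]
          refine and_congr_right fun hp' => ?_
          have a := rel p hp p' hp'
          have b := rel p' hp' p hp
          have hw' := wI p' hp'
          rw [Finset.mem_Icc]
          constructor
          · intro h
            refine ⟨hw'.1, ?_⟩
            omega
          · intro h
            by_contra hc
            have := b.2 (by omega)
            omega
        rw [e2, e]; omega
      · rw [show rankW ℓ g p = p from if_neg hp, w2 p (by simpa using hp)]

/-- `|R^ℓ_{A,B}| = |W^ℓ_{A,B}|`. -/
theorem card_RSet_eq_card_WSet (ℓ k r q : ℕ) (A B : ℕ → ℕ)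
    (hℓ : 1 ≤ ℓ) (hk : 1 ≤ k) (hr : 2 ≤ r) (hq : 2 ≤ q)
    (hAanti : ∀ i j, i ≤ j → j < r → A j ≤ A i)
    (hApos : ∀ i, i < r → 1 ≤ A i)
    (hAsum : ∑ i ∈ Finset.range r, A i = ℓ)
    (hBanti : ∀ i j, i ≤ j → j < q → B j ≤ B i)
    (hBpos : ∀ i, i < q → 1 ≤ B i)
    (hBsum : ∑ i ∈ Finset.range q, B i = ℓ)
    (hab : A 0 + B 0 ≤ k) :
    (RSet ℓ k r q A B).ncard = (WSet ℓ k r q A B).ncard := by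
  rw [card_RSet_eq (r + q) ℓ k r q A B hr hq (by omega) (by omega) hAsum,
    ← Pairs_rev (r + q) k r q _ B (by omega) (by omega),
    ← card_Mat_eq (r + q) k r q _ B (by omega), ← card_Wd_eq ℓ k r q _ B hBsum,
    card_W_eq ℓ k r q A B hAsum hBsum]
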